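/- Let L consist of a single binary relation symbol R and let T be the theory of directed graphs (so every L-structure is a model of T; in particular (α+1, ∈) is a world of Mod(T) for every ordinal α). Then Mod(T) is not bitotally bisimilar with any set-sized potentialist system: there is no set-sized potentialist system 𝓝 and bitotal bisimulation between Mod(T) and 𝓝. -/

import Mathlib

open FirstOrder Language

namespace Potentialist

/-- The underlying data of a potentialist system: a collection of worlds, each carrying a
first-order `L`-structure. -/
structure PreSys.{u, v, w, x} (L : FirstOrder.Language.{u, v}) where
  World : Type w
  Dom : World → Type x
  str : ∀ W, L.Structure (Dom W)

attribute [instance] PreSys.str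

/-- A potentialist system: a collection of first-order `L`-structures together with a
collection of `L`-embeddings between them, containing all identity embeddings and closed
under composition. -/
structure PotSys.{u, v, w, x} (L : FirstOrder.Language.{u, v})
    extends PreSys.{u, v, w, x} L where
  Emb : ∀ W W' : World, Set (Dom W ↪[L] Dom W')
  id_mem : ∀ W : World, Embedding.refl L (Dom W) ∈ Emb W W
  comp_mem : ∀ {W W' W'' : World} (f : Dom W ↪[L] Dom W') (g : Dom W' ↪[L] Dom W''),
    f ∈ Emb W W' → g ∈ Emb W' W'' → g.comp f ∈ Emb W W''

/-- Two tuples (in possibly different structures) satisfy the same atomic `L`-formulas. -/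
def AtomicEquiv.{u, v, y, z} (L : FirstOrder.Language.{u, v}) {M : Type y} {N : Type z}
    [L.Structure M] [L.Structure N] {n : ℕ} (a : Fin n → M) (b : Fin n → N) : Prop :=
  ∀ φ : L.Formula (Fin n), BoundedFormula.IsAtomic φ → (φ.Realize a ↔ φ.Realize b)

/-- The type of relations between pairs `(M, ā)` and `(N, b̄)` of equal parameter size. -/
abbrev BisimRel.{u, v, w, x, w', x'} {L : FirstOrder.Language.{u, v}}
    (S : PotSys.{u, v, w, x} L) (T : PotSys.{u, v, w', x'} L) :=
  ∀ (n : ℕ) (M : S.World), (Fin n → S.Dom M) → ∀ N : T.World, (Fin n → T.Dom N) → Prop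

/-- `R` is a bisimulation between the potentialist systems `S` and `T`: it is nonempty, and
whenever `R` relates `(M, ā)` to `(N, b̄)`: (B1) `ā` and `b̄` satisfy the same atomic formulas;
(B2) any extension of either tuple by one element can be matched on the other side;
(B3) any embedding on either side can be matched by an embedding on the other side. -/
def IsBisimulation.{u, v, w, x, w', x'} {L : FirstOrder.Language.{u, v}}
    (S : PotSys.{u, v, w, x} L) (T : PotSys.{u, v, w', x'} L) (R : BisimRel S T) : Prop :=
  (∃ n M a N b, R n M a N b) ∧
  ∀ (n : ℕ) (M : S.World) (a : Fin n → S.Dom M) (N : T.World) (b : Fin n → T.Dom N),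
    R n M a N b →
      AtomicEquiv L a b ∧
      (∀ c : S.Dom M, ∃ d : T.Dom N, R (n + 1) M (Fin.snoc a c) N (Fin.snoc b d)) ∧
      (∀ d : T.Dom N, ∃ c : S.Dom M, R (n + 1) M (Fin.snoc a c) N (Fin.snoc b d)) ∧
      (∀ (M' : S.World) (π : S.Dom M ↪[L] S.Dom M'), π ∈ S.Emb M M' →
        ∃ (N' : T.World) (ρ : T.Dom N ↪[L] T.Dom N'), ρ ∈ T.Emb N N' ∧
          R n M' (fun i => π (a i)) N' (fun i => ρ (b i))) ∧
      (∀ (N' : T.World) (ρ : T.Dom N ↪[L] T.Dom N'), ρ ∈ T.Emb N N' →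
        ∃ (M' : S.World) (π : S.Dom M ↪[L] S.Dom M'), π ∈ S.Emb M M' ∧
          R n M' (fun i => π (a i)) N' (fun i => ρ (b i)))

/-- Two pointed systems are bisimilar if some bisimulation relates them. -/
def Bisimilar.{u, v, w, x, w', x'} {L : FirstOrder.Language.{u, v}}
    (S : PotSys.{u, v, w, x} L) (T : PotSys.{u, v, w', x'} L)
    {n : ℕ} (M : S.World) (a : Fin n → S.Dom M) (N : T.World) (b : Fin n → T.Dom N) : Prop :=
  ∃ R : BisimRel S T, IsBisimulation S T R ∧ R n M a N b

/-- A relation is bitotal if every pair on the left is related to some pair on the right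
and vice versa. -/
def Bitotal.{u, v, w, x, w', x'} {L : FirstOrder.Language.{u, v}}
    (S : PotSys.{u, v, w, x} L) (T : PotSys.{u, v, w', x'} L) (R : BisimRel S T) : Prop :=
  (∀ (n : ℕ) (M : S.World) (a : Fin n → S.Dom M), ∃ N b, R n M a N b) ∧
  (∀ (n : ℕ) (N : T.World) (b : Fin n → T.Dom N), ∃ M a, R n M a N b)

/-- Two potentialist systems are bitotally bisimilar if there is a bitotal bisimulation
between them. -/
def BitotallyBisimilar.{u, v, w, x, w', x'} {L : FirstOrder.Language.{u, v}}
    (S : PotSys.{u, v, w, x} L) (T : PotSys.{u, v, w', x'} L) : Prop :=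
  ∃ R : BisimRel S T, IsBisimulation S T R ∧ Bitotal S T R

/-- An iso-bisimulation between potentialist systems: a nonempty relation between worlds
together with a system of isomorphisms, such that embeddings on either side can be matched
by embeddings on the other side, commuting with the isomorphisms. -/
structure IsoBisim.{u, v, w, x, w', x'} {L : FirstOrder.Language.{u, v}}
    (S : PotSys.{u, v, w, x} L) (T : PotSys.{u, v, w', x'} L) where
  rel : S.World → T.World → Prop
  nonempty : ∃ M N, rel M N
  iso : ∀ {M : S.World} {N : T.World}, rel M N → (S.Dom M ≃[L] T.Dom N)
  forth : ∀ {M : S.World} {N : T.World} (h : rel M N) (M' : S.World)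
      (π : S.Dom M ↪[L] S.Dom M'), π ∈ S.Emb M M' →
      ∃ (N' : T.World) (ρ : T.Dom N ↪[L] T.Dom N') (_ : ρ ∈ T.Emb N N') (h' : rel M' N'),
        ∀ y : S.Dom M, iso h' (π y) = ρ (iso h y)
  back : ∀ {M : S.World} {N : T.World} (h : rel M N) (N' : T.World)
      (ρ : T.Dom N ↪[L] T.Dom N'), ρ ∈ T.Emb N N' →
      ∃ (M' : S.World) (π : S.Dom M ↪[L] S.Dom M') (_ : π ∈ S.Emb M M') (h' : rel M' N'),
        ∀ y : S.Dom M, iso h' (π y) = ρ (iso h y)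

/-- An iso-bisimulation is bitotal if every world on either side takes part in the relation. -/
def IsoBisim.Bitotal.{u, v, w, x, w', x'} {L : FirstOrder.Language.{u, v}}
    {S : PotSys.{u, v, w, x} L} {T : PotSys.{u, v, w', x'} L} (I : IsoBisim S T) : Prop :=
  (∀ M : S.World, ∃ N, I.rel M N) ∧ (∀ N : T.World, ∃ M, I.rel M N)


/-- A model of a theory `T` realized concretely on a (set-sized) subset of a fixed ambient
class `A`. -/
structure CModel.{u, v} (L : FirstOrder.Language.{u, v}) (T : L.Theory)
    (A : Type (max u v + 1)) where
  carrier : Set A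
  small : Small.{max u v} (carrier : Type (max u v + 1))
  struc : L.Structure carrier
  models : @Theory.Model L carrier struc T

attribute [instance] CModel.struc

/-- The substructure potentialist system `Mod(T)`: its worlds are all models of `T` carried
on subsets of the ambient class `A`, and its embeddings are exactly the substructure
inclusion maps. -/
def ModSub.{u, v} (L : FirstOrder.Language.{u, v}) (T : L.Theory)
    (A : Type (max u v + 1)) : PotSys.{u, v, max u v + 1, max u v + 1} L where
  World := CModel L T A
  Dom M := M.carrier
  str M := M.struc
  Emb M N := {f : M.carrier ↪[L] N.carrier | ∀ y : M.carrier, (f y : A) = (y : A)}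
  id_mem M := fun y => rfl
  comp_mem f g hf hg := fun y => (hg (f y)).trans (hf y)

/-- The embedding potentialist system `Mod_e(T)`: its worlds are all models of `T` carried
on subsets of the ambient class `A`, and it contains all `L`-embeddings between them. -/
def ModEmb.{u, v} (L : FirstOrder.Language.{u, v}) (T : L.Theory)
    (A : Type (max u v + 1)) : PotSys.{u, v, max u v + 1, max u v + 1} L where
  World := CModel L T A
  Dom M := M.carrier
  str M := M.struc
  Emb M N := Set.univ
  id_mem M := trivial
  comp_mem _ _ _ _ := trivial

/-- The subsystem `Mod_{κ⁺}(T)` of the substructure potentialist system `Mod(T)` consisting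
of the models of cardinality at most `κ`. -/
def ModSubLe.{u, v} (L : FirstOrder.Language.{u, v}) (T : L.Theory)
    (A : Type (max u v + 1)) (κ : Cardinal.{max u v}) :
    PotSys.{u, v, max u v + 1, max u v + 1} L where
  World := {M : CModel L T A // Cardinal.mk M.carrier ≤ Cardinal.lift.{max u v + 1} κ}
  Dom M := M.1.carrier
  str M := M.1.struc
  Emb M N := {f : M.1.carrier ↪[L] N.1.carrier | ∀ y : M.1.carrier, (f y : A) = (y : A)}
  id_mem M := fun y => rfl
  comp_mem f g hf hg := fun y => (hg (f y)).trans (hf y)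


theorem AtomicEquiv.relMap_adj_iff {M N : Type*} [FirstOrder.Language.graph.Structure M]
    [FirstOrder.Language.graph.Structure N] {n : ℕ} {a : Fin n → M} {b : Fin n → N}
    (h : AtomicEquiv FirstOrder.Language.graph a b) (i j : Fin n) :
    Structure.RelMap adj ![a i, a j] ↔ Structure.RelMap adj ![b i, b j] := by
  simpa [Formula.realize_rel₂] using
    h (adj.formula₂ (Term.var i) (Term.var j)) (BoundedFormula.IsAtomic.rel _ _)

/-- `rk` identifies the digraph `M`, up to duplication of vertices, with the ordinal `o` under
its strict order. -/
structure IsOrdinalRank {M : Type*} [FirstOrder.Language.graph.Structure M]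
    (rk : M → Ordinal.{0}) (o : Ordinal.{0}) : Prop where
  range_eq : Set.range rk = Set.Iio o
  relMap_adj_iff : ∀ x y : M, Structure.RelMap adj ![x, y] ↔ rk x < rk y

theorem IsOrdinalRank.exists_eq {M : Type*} [FirstOrder.Language.graph.Structure M]
    {rk : M → Ordinal.{0}} {o z : Ordinal.{0}} (h : IsOrdinalRank rk o) (hz : z < o) :
    ∃ c, rk c = z := by
  have hz' : z ∈ Set.range rk := h.range_eq ▸ hz
  exact hz'

theorem IsOrdinalRank.lt {M : Type*} [FirstOrder.Language.graph.Structure M]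
    {rk : M → Ordinal.{0}} {o : Ordinal.{0}} (h : IsOrdinalRank rk o) (c : M) : rk c < o := by
  have hc : rk c ∈ Set.Iio o := h.range_eq ▸ Set.mem_range_self c
  exact hc

section

variable {S : PotSys FirstOrder.Language.graph} {T : PotSys FirstOrder.Language.graph}
  {R : BisimRel S T} {M M' : S.World} {N : T.World}
  {rk : S.Dom M → Ordinal.{0}} {rk' : S.Dom M' → Ordinal.{0}} {o o' : Ordinal.{0}}

/-- Tuples in two ordinals that are bisimilar to the same tuple have the same ranks. -/
theorem IsBisimulation.rank_eq (hR : IsBisimulation S T R) (hM : IsOrdinalRank rk o)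
    (hM' : IsOrdinalRank rk' o') {n : ℕ} {a : Fin n → S.Dom M} {a' : Fin n → S.Dom M'}
    {b : Fin n → T.Dom N} (h : R n M a N b) (h' : R n M' a' N b) (i : Fin n) :
    rk (a i) = rk' (a' i) := by
  induction hz : rk (a i) using WellFoundedLT.induction generalizing n with
  | ind z ih =>
    subst hz
    have last_lt_iff : ∀ {c d c'}, R (n + 1) M (Fin.snoc a c) N (Fin.snoc b d) →
        R (n + 1) M' (Fin.snoc a' c') N (Fin.snoc b d) →
        (rk c < rk (a i) ↔ rk' c' < rk' (a' i)) := by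
      intro c d c' hc hc'
      have e := ((hR.2 _ _ _ _ _ hc).1.relMap_adj_iff (Fin.last n) i.castSucc).trans
        ((hR.2 _ _ _ _ _ hc').1.relMap_adj_iff (Fin.last n) i.castSucc).symm
      simpa only [Fin.snoc_last, Fin.snoc_castSucc, hM.relMap_adj_iff, hM'.relMap_adj_iff] using e
    have last_eq : ∀ {c d c'}, R (n + 1) M (Fin.snoc a c) N (Fin.snoc b d) →
        R (n + 1) M' (Fin.snoc a' c') N (Fin.snoc b d) → rk c < rk (a i) → rk c = rk' c' := by
      intro c d c' hc hc' hlt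
      simpa using ih (rk c) hlt hc hc' (Fin.last n) (by simp)
    apply le_antisymm
    · refine le_of_forall_lt fun z hz => ?_
      obtain ⟨c, rfl⟩ := hM.exists_eq (hz.trans (hM.lt _))
      obtain ⟨d, hd⟩ := (hR.2 _ _ _ _ _ h).2.1 c
      obtain ⟨c', hc'⟩ := (hR.2 _ _ _ _ _ h').2.2.1 d
      rw [last_eq hd hc' hz]
      exact (last_lt_iff hd hc').1 hz
    · refine le_of_forall_lt fun z hz => ?_
      obtain ⟨c', rfl⟩ := hM'.exists_eq (hz.trans (hM'.lt _))
      obtain ⟨d, hd⟩ := (hR.2 _ _ _ _ _ h').2.1 c'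
      obtain ⟨c, hc⟩ := (hR.2 _ _ _ _ _ h).2.2.1 d
      have hlt := (last_lt_iff hc hd).2 hz
      exact last_eq hc hd hlt ▸ hlt

theorem IsBisimulation.ordinal_le (hR : IsBisimulation S T R) (hM : IsOrdinalRank rk o)
    (hM' : IsOrdinalRank rk' o') {n : ℕ} {a : Fin n → S.Dom M} {a' : Fin n → S.Dom M'}
    {b : Fin n → T.Dom N} (h : R n M a N b) (h' : R n M' a' N b) : o ≤ o' := by
  refine le_of_forall_lt fun z hz => ?_
  obtain ⟨c, rfl⟩ := hM.exists_eq hz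
  obtain ⟨d, hd⟩ := (hR.2 _ _ _ _ _ h).2.1 c
  obtain ⟨c', hc'⟩ := (hR.2 _ _ _ _ _ h').2.2.1 d
  have e : rk c = rk' c' := by simpa using hR.rank_eq hM hM' hd hc' (Fin.last n)
  exact e ▸ hM'.lt c'

end

theorem exists_ordinal_embedding {A : Type 1} (hA : ¬ Small.{0} A) :
    Nonempty (Ordinal.{0} ↪ A) := by
  rw [Cardinal.small_iff_lift_mk_lt_univ, not_lt] at hA
  rw [← Cardinal.lift_mk_le', Cardinal.mk_ordinal]
  simpa using hA

theorem exists_cmodel_isOrdinalRank {A : Type 1} (f : Ordinal.{0} ↪ A) (o : Ordinal.{0}) :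
    ∃ (M : CModel FirstOrder.Language.graph ∅ A) (rk : M.carrier → Ordinal.{0}),
      IsOrdinalRank rk o := by
  let str : FirstOrder.Language.graph.Structure (f '' Set.Iio o) :=
    { funMap := fun g => g.elim
      RelMap := fun r => match r with
        | .adj => fun v => Function.invFun f (v 0 : A) < Function.invFun f (v 1 : A) }
  refine ⟨⟨f '' Set.Iio o, inferInstance, str, inferInstance⟩,
    fun x => Function.invFun f (x : A), ?_, fun x y => Iff.rfl⟩
  have hf := Function.leftInverse_invFun f.injective
  ext z
  constructor
  · rintro ⟨⟨_, w, hw, rfl⟩, rfl⟩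
    simpa [hf w] using hw
  · exact fun hz => ⟨⟨f z, z, hz, rfl⟩, hf z⟩

/-- let `L` consist of a single binary relation symbol and let `T` be the
theory of directed graphs (every `L`-structure is a model).  Then the substructure
potentialist system `Mod(T)` (over a proper-class-sized ambient class `A`) is not bitotally
bisimilar with any set-sized potentialist system. -/
theorem modSub_digraph_not_bitotallyBisimilar_set_sized
    (A : Type 1) (hA : ¬ Small.{0} A) :
    ¬ ∃ N : PotSys.{0, 0, 0, 0} FirstOrder.Language.graph,
        BitotallyBisimilar (ModSub FirstOrder.Language.graph ∅ A) N := by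
  rintro ⟨N, R, hR, hR_left, -⟩
  obtain ⟨f⟩ := exists_ordinal_embedding hA
  choose M rk hrk using exists_cmodel_isOrdinalRank f
  choose W b hb using fun o => hR_left 0 (M o) Fin.elim0
  have le_of_eq : ∀ o o', W o = W o' → o ≤ o' := by
    intro o o' h
    have hbo := hb o
    have hbo' := hb o'
    generalize b o = c at hbo
    generalize b o' = c' at hbo'
    revert c c'
    rw [h]
    intro c hbo c' hbo'
    exact hR.ordinal_le (hrk o) (hrk o') hbo (Subsingleton.elim c' c ▸ hbo')
  exact not_small_ordinal.{0, 0} <| small_of_injective (f := W) fun o o' h =>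
    le_antisymm (le_of_eq _ _ h) (le_of_eq _ _ h.symm)

end Potentialist
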